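/- Let M₄ be the Turing machine with states {A,B,C,D,E,F,H} and symbols {0,1} whose transition table is: δ(A,0)=(1,R,B), δ(A,1)=(1,L,E); δ(B,0)=(1,R,C), δ(B,1)=(1,R,F); δ(C,0)=(1,L,D), δ(C,1)=(0,R,B); δ(D,0)=(1,R,E), δ(D,1)=(0,L,C); δ(E,0)=(1,L,A), δ(E,1)=(0,R,D); δ(F,0)=(1,R,H), δ(F,1)=(1,R,C). Then, started on a blank tape, M₄ halts: ^ω0 (A0) 0^ω ⊢(s) ^ω0 1 1 1 (011)^K (H0) 0^ω, where s = (125·16^{30341} + 1750·4^{30340} + 15)/27 + 19885154163 and K = (50·4^{30340} − 2)/9. In particular M₄ halts in exactly s steps and its halting configuration carries exactly (25·4^{30341} + 23)/9 symbols 1. -/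

import Mathlib

open Turing

inductive TSt where | A | B | C | D | E | F | H
deriving DecidableEq

inductive Gam where | s0 | s1
deriving DecidableEq

instance : Inhabited Gam := ⟨Gam.s0⟩

abbrev Cfg := TSt × Tape Gam

/-- The transition table of the machine (values from the halting state `H` are never used). -/
def delta : TSt → Gam → Gam × Dir × TSt
  | .A, .s0 => (.s1, Dir.right, .B)
  | .A, .s1 => (.s1, Dir.left, .E)
  | .B, .s0 => (.s1, Dir.right, .C)
  | .B, .s1 => (.s1, Dir.right, .F)
  | .C, .s0 => (.s1, Dir.left, .D)
  | .C, .s1 => (.s0, Dir.right, .B)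
  | .D, .s0 => (.s1, Dir.right, .E)
  | .D, .s1 => (.s0, Dir.left, .C)
  | .E, .s0 => (.s1, Dir.left, .A)
  | .E, .s1 => (.s0, Dir.right, .D)
  | .F, .s0 => (.s1, Dir.right, .H)
  | .F, .s1 => (.s1, Dir.right, .C)
  | .H, a => (a, Dir.right, .H)

/-- One computation step; `none` if the current state is the halting state `H`. -/
def step (c : Cfg) : Option Cfg :=
  if c.1 = TSt.H then none
  else
    let t := delta c.1 c.2.head
    some (t.2.2, (c.2.write t.1).move t.2.1)

/-- `reaches t c₁ c₂` : iterating `step` exactly `t` times starting from `c₁` yields `c₂`. -/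
def reaches (t : ℕ) (c₁ c₂ : Cfg) : Prop :=
  (fun c => Option.bind c step)^[t] (some c₁) = some c₂

/-- The configuration `^ω0 x (q a) y 0^ω` : state `q`, head reading `a`, the word `x`
written immediately to the left of the head (in order), `y` immediately to the right,
blank elsewhere. -/
def mkCfg (x : List Gam) (q : TSt) (a : Gam) (y : List Gam) : Cfg :=
  (q, ⟨a, ListBlank.mk x.reverse, ListBlank.mk y⟩)

/-- A configuration whose left half-tape is the list `l` (nearest cell first) and whose right
half-tape is the list `r`, blank elsewhere. -/
def listCfg (q : TSt) (l : List Gam) (a : Gam) (r : List Gam) : Cfg :=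
  (q, ⟨a, ListBlank.mk l, ListBlank.mk r⟩)

/-- `alt a b n l` is `(ab)^n` prepended to `l`. -/
def alt (a b : Gam) : ℕ → List Gam → List Gam
  | 0, l => l
  | n + 1, l => a :: b :: alt a b n l

/-- `tri a b c n l` is `(abc)^n` prepended to `l`. -/
def tri (a b c : Gam) : ℕ → List Gam → List Gam
  | 0, l => l
  | n + 1, l => a :: b :: c :: tri a b c n l

theorem alt_append (a b : Gam) (n : ℕ) (l : List Gam) :
    alt a b n (a :: b :: l) = alt a b (n + 1) l := by
  induction n with
  | zero => rfl
  | succ n ih => rw [alt, ih]; rfl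

theorem alt_rotate (a b : Gam) (n : ℕ) (l : List Gam) :
    alt a b n (a :: l) = a :: alt b a n l := by
  induction n with
  | zero => rfl
  | succ n ih => rw [alt, ih]; rfl

theorem tri_append (a b c : Gam) (n : ℕ) (l : List Gam) :
    tri a b c n (a :: b :: c :: l) = tri a b c (n + 1) l := by
  induction n with
  | zero => rfl
  | succ n ih => rw [tri, ih]; rfl

theorem tri_rotate (a b c : Gam) (n : ℕ) (l : List Gam) :
    tri a b c n (a :: l) = a :: tri b c a n l := by
  induction n with
  | zero => rfl
  | succ n ih => rw [tri, ih]; rfl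

theorem alt_self (a : Gam) (n : ℕ) (l : List Gam) :
    alt a a n l = List.replicate (2 * n) a ++ l := by
  induction n with
  | zero => rfl
  | succ n ih => rw [alt, ih]; rfl

theorem tri_self (a : Gam) (n : ℕ) (l : List Gam) :
    tri a a a n l = List.replicate (3 * n) a ++ l := by
  induction n with
  | zero => rfl
  | succ n ih => rw [tri, ih]; rfl

theorem tri_eq_flatten (a b c : Gam) (n : ℕ) (l : List Gam) :
    tri a b c n l = (List.replicate n [a, b, c]).flatten ++ l := by
  induction n with
  | zero => rfl
  | succ n ih => rw [tri, ih]; simp [List.replicate_succ]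

theorem tri_reverse (a b c : Gam) (n : ℕ) (l : List Gam) :
    ((List.replicate n [a, b, c]).flatten).reverse ++ l = tri c b a n l := by
  rw [tri_eq_flatten]; simp [List.reverse_flatten]

theorem reaches.trans {s t : ℕ} {c₁ c₂ c₃ : Cfg} (h₁ : reaches s c₁ c₂) (h₂ : reaches t c₂ c₃) :
    reaches (s + t) c₁ c₃ := by
  unfold reaches at *
  rw [Nat.add_comm, Function.iterate_add_apply, h₁, h₂]

theorem reaches.cast {s t : ℕ} {c₁ c₂ : Cfg} (h : reaches s c₁ c₂) (e : s = t) :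
    reaches t c₁ c₂ := e ▸ h

theorem reaches_zero_iff (c₁ c₂ : Cfg) : reaches 0 c₁ c₂ ↔ c₁ = c₂ := by
  simp [reaches]

/-- Carry out the write, move and change of state prescribed by a table entry. -/
def act : Gam × Dir × TSt → List Gam → List Gam → Cfg
  | (b, Dir.right, q), l, r => listCfg q (b :: l) r.headI r.tail
  | (b, Dir.left, q), l, r => listCfg q l.tail l.headI (b :: r)

theorem reaches_succ_iff {q : TSt} (hq : q ≠ .H) (a : Gam) (n : ℕ) (l r : List Gam) (c : Cfg) :
    reaches (n + 1) (listCfg q l a r) c ↔ reaches n (act (delta q a) l r) c := by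
  have : step (listCfg q l a r) = some (act (delta q a) l r) := by
    rcases h : delta q a with ⟨b, d, q'⟩
    cases d <;> simp [step, listCfg, act, hq, h, Tape.move, Tape.write]
  simp [reaches, this]

theorem default_eq_s0 : (default : Gam) = .s0 := rfl

attribute [local simp] reaches_zero_iff reaches_succ_iff act delta List.headI default_eq_s0

/-! ### Sweeps over periodic words -/

theorem sweep_left_D (n : ℕ) (w r : List Gam) :
    reaches (2 * n) (listCfg .D (alt .s0 .s1 n w) .s1 r) (listCfg .D w .s1 (alt .s1 .s0 n r)) := by
  induction n generalizing r with
  | zero => rfl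
  | succ n ih =>
    have h : reaches 2 (listCfg .D (.s0 :: .s1 :: alt .s0 .s1 n w) .s1 r)
      (listCfg .D (alt .s0 .s1 n w) .s1 (.s1 :: .s0 :: r)) := rfl
    have := h.trans (ih _)
    rw [alt_append] at this
    exact this.cast (by ring)

theorem sweep_left_A (n : ℕ) (w r : List Gam) :
    reaches (2 * n) (listCfg .A (alt .s0 .s1 n w) .s1 r) (listCfg .A w .s1 (alt .s1 .s1 n r)) := by
  induction n generalizing r with
  | zero => rfl
  | succ n ih =>
    have h : reaches 2 (listCfg .A (.s0 :: .s1 :: alt .s0 .s1 n w) .s1 r)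
      (listCfg .A (alt .s0 .s1 n w) .s1 (.s1 :: .s1 :: r)) := rfl
    have := h.trans (ih _)
    rw [alt_append] at this
    exact this.cast (by ring)

theorem sweep_right_E (n : ℕ) (w : List Gam) (c : Gam) (r : List Gam) :
    reaches (2 * n + 2) (listCfg .E w .s1 (.s0 :: alt .s1 .s0 n (c :: r)))
      (listCfg .E (alt .s1 .s0 (n + 1) w) c r) := by
  induction n generalizing w with
  | zero => rfl
  | succ n ih =>
    have h : reaches 2 (listCfg .E w .s1 (.s0 :: alt .s1 .s0 (n + 1) (c :: r)))
      (listCfg .E (.s1 :: .s0 :: w) .s1 (.s0 :: alt .s1 .s0 n (c :: r))) := rfl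
    have := h.trans (ih _)
    rw [alt_append] at this
    exact this.cast (by ring)

theorem sweep_right_C (n : ℕ) (w : List Gam) (c : Gam) (r : List Gam) :
    reaches (2 * n + 2) (listCfg .C w .s1 (.s0 :: alt .s1 .s0 n (c :: r)))
      (listCfg .C (alt .s1 .s0 (n + 1) w) c r) := by
  induction n generalizing w with
  | zero => rfl
  | succ n ih =>
    have h : reaches 2 (listCfg .C w .s1 (.s0 :: alt .s1 .s0 (n + 1) (c :: r)))
      (listCfg .C (.s1 :: .s0 :: w) .s1 (.s0 :: alt .s1 .s0 n (c :: r))) := rfl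
    have := h.trans (ih _)
    rw [alt_append] at this
    exact this.cast (by ring)

theorem sweep_right_ones (n : ℕ) (w r : List Gam) :
    reaches (3 * n) (listCfg .C w .s1 (tri .s1 .s1 .s1 n r))
      (listCfg .C (tri .s1 .s1 .s0 n w) .s1 r) := by
  induction n generalizing w with
  | zero => rfl
  | succ n ih =>
    have h : reaches 3 (listCfg .C w .s1 (tri .s1 .s1 .s1 (n + 1) r))
      (listCfg .C (.s1 :: .s1 :: .s0 :: w) .s1 (tri .s1 .s1 .s1 n r)) := rfl
    have := h.trans (ih _)
    rw [tri_append] at this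
    exact this.cast (by ring)

/-! ### Behaviour at the right end of the tape -/

/-- The word `1^9`. -/
def nineOnes : List Gam := List.replicate 9 .s1

/-- The configuration `^ω0 u (01)^b 101101 (C0) 0^ω`, with `u` given reversed. -/
def shortEnd (b : ℕ) (u : List Gam) : Cfg :=
  listCfg .C (.s1 :: .s0 :: .s1 :: .s1 :: .s0 :: .s1 :: alt .s1 .s0 b u) .s0 []

/-- The configuration `^ω0 u (01)^b 1011011 (C0) 0^ω`, with `u` given reversed. -/
def longEnd (b : ℕ) (u : List Gam) : Cfg :=
  listCfg .C (.s1 :: .s1 :: .s0 :: .s1 :: .s1 :: .s0 :: .s1 :: alt .s1 .s0 b u) .s0 []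

theorem shortEnd_bounce (b : ℕ) (u : List Gam) :
    reaches 37 (shortEnd b u) (listCfg .D (.s0 :: alt .s1 .s0 b u) .s1 nineOnes) := by
  simp [shortEnd, nineOnes, List.replicate]

theorem turn (b : ℕ) (u : List Gam) (c : Gam) (r : List Gam) :
    reaches (4 * b + 7) (listCfg .D (alt .s0 .s1 b (.s0 :: .s1 :: .s1 :: u)) .s1 (c :: r))
      (listCfg .C (alt .s1 .s0 (b + 2) u) c r) := by
  have h₁ := sweep_left_D b (.s0 :: .s1 :: .s1 :: u) (c :: r)
  have h₂ : reaches 3 (listCfg .D (.s0 :: .s1 :: .s1 :: u) .s1 (alt .s1 .s0 b (c :: r)))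
    (listCfg .C u .s1 (.s0 :: alt .s1 .s0 (b + 1) (c :: r))) := rfl
  exact ((h₁.trans h₂).trans (sweep_right_C (b + 1) u c r)).cast (by ring)

theorem shortEnd_finish (b : ℕ) (u : List Gam) :
    reaches 8 (listCfg .C (alt .s1 .s0 b u) .s1 (List.replicate 6 .s1)) (shortEnd (b + 1) u) := rfl

theorem longEnd_finish (b : ℕ) (u : List Gam) :
    reaches 9 (listCfg .C (alt .s1 .s0 b u) .s1 (List.replicate 8 .s1)) (longEnd (b + 1) u) := rfl

theorem longEnd_restart (u : List Gam) :
    reaches 46 (longEnd 0 (.s1 :: u)) (shortEnd 4 u) := by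
  simp [longEnd, shortEnd, alt]

theorem initial_groups (u : List Gam) :
    reaches 57 (listCfg .C (.s1 :: tri .s0 .s1 .s1 3 u) .s0 []) (longEnd 4 u) := by
  simp [longEnd, alt, tri]

theorem blank_start :
    reaches 40 (listCfg .A [] .s0 []) (listCfg .C (.s1 :: tri .s0 .s1 .s1 3 [.s1]) .s0 []) := by
  simp [tri]

theorem shortEnd_consume_pair (b : ℕ) (u : List Gam) :
    reaches (8 * b + 62) (shortEnd b (.s0 :: .s1 :: u)) (shortEnd (b + 4) u) := by
  have h₁ := shortEnd_bounce b (.s0 :: .s1 :: u)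
  rw [← alt_rotate] at h₁
  have h₂ := sweep_left_D b (.s0 :: .s0 :: .s1 :: u) nineOnes
  have h₃ : reaches 3 (listCfg .D (.s0 :: .s0 :: .s1 :: u) .s1 (alt .s1 .s0 b nineOnes))
    (listCfg .E (.s1 :: .s1 :: u) .s1 (.s0 :: alt .s1 .s0 b nineOnes)) := rfl
  have h₄ := sweep_right_E b (.s1 :: .s1 :: u) .s1 (List.replicate 8 .s1)
  have h₅ : reaches 1 (listCfg .E (alt .s1 .s0 (b + 1) (.s1 :: .s1 :: u)) .s1 (List.replicate 8 .s1))
    (listCfg .D (.s0 :: alt .s1 .s0 (b + 1) (.s1 :: .s1 :: u)) .s1 (List.replicate 7 .s1)) := rfl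
  rw [← alt_rotate] at h₅
  have h₆ := turn (b + 1) u .s1 (List.replicate 6 .s1)
  exact ((((((h₁.trans h₂).trans h₃).trans h₄).trans h₅).trans h₆).trans
    (shortEnd_finish (b + 3) u)).cast (by ring)

theorem shortEnd_consume_group_zero (b : ℕ) (u : List Gam) :
    reaches (8 * b + 66) (shortEnd b (.s0 :: .s0 :: .s1 :: .s1 :: u)) (shortEnd (b + 5) u) := by
  have h₁ := shortEnd_bounce b (.s0 :: .s0 :: .s1 :: .s1 :: u)
  rw [← alt_rotate] at h₁
  have h₂ := sweep_left_D b (.s0 :: .s0 :: .s0 :: .s1 :: .s1 :: u) nineOnes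
  have h₃ : reaches 3
    (listCfg .D (.s0 :: .s0 :: .s0 :: .s1 :: .s1 :: u) .s1 (alt .s1 .s0 b nineOnes))
    (listCfg .E (alt .s1 .s0 1 (.s1 :: .s1 :: u)) .s1 (.s0 :: alt .s1 .s0 b nineOnes)) := rfl
  have h₄ := sweep_right_E b (alt .s1 .s0 1 (.s1 :: .s1 :: u)) .s1 (List.replicate 8 .s1)
  have h₅ : reaches 1
    (listCfg .E (alt .s1 .s0 (b + 1) (alt .s1 .s0 1 (.s1 :: .s1 :: u))) .s1 (List.replicate 8 .s1))
    (listCfg .D (.s0 :: alt .s1 .s0 (b + 1) (alt .s1 .s0 1 (.s1 :: .s1 :: u))) .s1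
      (List.replicate 7 .s1)) := rfl
  rw [show alt .s1 .s0 (b + 1) (alt .s1 .s0 1 (.s1 :: .s1 :: u)) =
    alt .s1 .s0 (b + 2) (.s1 :: .s1 :: u) from alt_append _ _ _ _] at h₄ h₅
  rw [← alt_rotate] at h₅
  have h₆ := turn (b + 2) u .s1 (List.replicate 6 .s1)
  exact ((((((h₁.trans h₂).trans h₃).trans h₄).trans h₅).trans h₆).trans
    (shortEnd_finish (b + 4) u)).cast (by ring)

theorem shortEnd_consume_ones (b : ℕ) (u : List Gam) :
    reaches (4 * b + 53) (shortEnd b (.s1 :: .s1 :: u)) (longEnd (b + 3) u) := by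
  have h₁ := shortEnd_bounce b (.s1 :: .s1 :: u)
  rw [← alt_rotate] at h₁
  have h₂ := turn b u .s1 (List.replicate 8 .s1)
  exact ((h₁.trans h₂).trans (longEnd_finish (b + 2) u)).cast (by ring)

theorem shortEnd_consume_pairs (n b : ℕ) (u : List Gam) :
    reaches (8 * b * n + 16 * n * n + 46 * n) (shortEnd b (.s0 :: alt .s1 .s0 n u))
      (shortEnd (b + 4 * n) (.s0 :: u)) := by
  induction n generalizing b with
  | zero => rfl
  | succ n ih =>
    have h := (shortEnd_consume_pair b (.s0 :: alt .s1 .s0 n u)).trans (ih (b + 4))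
    rw [show b + 4 + 4 * n = b + 4 * (n + 1) by ring] at h
    exact h.cast (by ring)

theorem longEnd_unfold (n : ℕ) (u : List Gam) :
    reaches (16 * n * n + 78 * n + 46) (longEnd (n + 1) u) (shortEnd (4 * n + 4) (.s0 :: u)) := by
  have h := (longEnd_restart (.s0 :: alt .s1 .s0 n u)).trans (shortEnd_consume_pairs n 4 u)
  rw [Nat.add_comm 4] at h
  exact h.cast (by ring)

/-- Three groups `110` are consumed while the periodic part is roughly quadrupled. -/
theorem longEnd_round (k n : ℕ) (w : List Gam) :
    reaches (16 * n * n + 158 * n + 387) (longEnd (n + 1) (tri .s0 .s1 .s1 (k + 3) w))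
      (longEnd (4 * n + 17) (tri .s0 .s1 .s1 k w)) := by
  have h₁ := longEnd_unfold n (tri .s0 .s1 .s1 (k + 3) w)
  have h₂ := shortEnd_consume_group_zero (4 * n + 4) (tri .s0 .s1 .s1 (k + 2) w)
  have h₃ := shortEnd_consume_pair (4 * n + 9) (.s1 :: tri .s0 .s1 .s1 (k + 1) w)
  have e : shortEnd (4 * n + 9 + 4) (.s1 :: tri .s0 .s1 .s1 (k + 1) w) =
      shortEnd (4 * n + 14) (.s1 :: .s1 :: tri .s0 .s1 .s1 k w) := by
    simp only [shortEnd, tri, alt_append]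
  rw [e] at h₃
  have h₄ := shortEnd_consume_ones (4 * n + 14) (tri .s0 .s1 .s1 k w)
  exact (((h₁.trans h₂).trans h₃).trans h₄).cast (by ring)

/-- Iterated rounds, with the length and the running time given by their closed forms. -/
theorem longEnd_rounds (j k : ℕ) (w : List Gam) :
    ∃ n t, reaches t (longEnd 4 (tri .s0 .s1 .s1 (k + 3 * j) w))
        (longEnd (n + 1) (tri .s0 .s1 .s1 k w)) ∧
      3 * n + 16 = 25 * 4 ^ j ∧
      27 * t + 15 * j + 950 * 4 ^ j + 1050 = 2000 * (4 ^ j * 4 ^ j) := by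
  induction j generalizing k with
  | zero => exact ⟨3, 0, rfl, rfl, rfl⟩
  | succ j ih =>
    obtain ⟨n, t, h, hn, ht⟩ := ih (k + 3)
    rw [show k + 3 + 3 * j = k + 3 * (j + 1) by ring] at h
    refine ⟨4 * n + 16, _, h.trans (longEnd_round k n w), ?_, ?_⟩
    · rw [pow_succ]; omega
    · rw [pow_succ]
      generalize 4 ^ j = x at *
      zify at *
      have hx : (3 * n : ℤ) = 25 * x - 16 := by linarith
      have : (9 * (n * n) : ℤ) = (25 * x - 16) ^ 2 := by rw [← hx]; ring
      linarith

/-! ### Behaviour at the left end of the tape -/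

theorem widen (c : ℕ) (s : List Gam) :
    reaches (4 * c + 6) (listCfg .D (alt .s0 .s1 c []) .s1 (.s1 :: s))
      (listCfg .D (alt .s0 .s1 (c + 2) []) s.headI s.tail) := by
  have h₁ := sweep_left_D c [] (.s1 :: s)
  have h₂ : reaches 3 (listCfg .D [] .s1 (alt .s1 .s0 c (.s1 :: s)))
    (listCfg .E [.s1] .s1 (.s0 :: alt .s1 .s0 c (.s1 :: s))) := rfl
  have h₃ := sweep_right_E c [.s1] .s1 s
  have h₄ : reaches 1 (listCfg .E (alt .s1 .s0 (c + 1) [.s1]) .s1 s)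
    (listCfg .D (.s0 :: alt .s1 .s0 (c + 1) [.s1]) s.headI s.tail) := rfl
  rw [← alt_rotate, alt_append] at h₄
  exact (((h₁.trans h₂).trans h₃).trans h₄).cast (by ring)

theorem fill_with_ones (c : ℕ) :
    reaches (2 * c + 7) (listCfg .D (alt .s0 .s1 c []) .s0 [])
      (listCfg .C [.s1, .s1, .s1] .s1 (List.replicate (2 * c) .s1)) := by
  have h₁ : reaches 2 (listCfg .D (alt .s0 .s1 c []) .s0 [])
    (listCfg .A (alt .s0 .s1 c []) .s1 [.s1]) := rfl
  have h₂ := sweep_left_A c [] [.s1]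
  rw [alt_rotate] at h₂
  have h₃ : reaches 5 (listCfg .A [] .s1 (.s1 :: alt .s1 .s1 c []))
    (listCfg .C [.s1, .s1, .s1] .s1 (alt .s1 .s1 c [])) := rfl
  have h := ((h₁.trans h₂).trans h₃).cast (t := 2 * c + 7) (by ring)
  rwa [alt_self, List.append_nil] at h

theorem shortEnd_regroup (b m : ℕ) (hm : 3 * m = 2 * b + 20) :
    reaches (22 * b + 176 + 3 * m) (shortEnd b [])
      (listCfg .C (.s1 :: tri .s0 .s1 .s1 (m + 1) [.s1]) .s0 []) := by
  have h₁ := shortEnd_bounce b []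
  rw [← alt_rotate] at h₁
  have h₂ := sweep_left_D b [.s0] nineOnes
  have h₃ : reaches 3 (listCfg .D [.s0] .s1 (alt .s1 .s0 b nineOnes))
    (listCfg .E [.s1] .s1 (.s0 :: alt .s1 .s0 b nineOnes)) := rfl
  have h₄ := sweep_right_E b [.s1] .s1 (List.replicate 8 .s1)
  have h₅ : reaches 1 (listCfg .E (alt .s1 .s0 (b + 1) [.s1]) .s1 (List.replicate 8 .s1))
    (listCfg .D (.s0 :: alt .s1 .s0 (b + 1) [.s1]) .s1 (List.replicate 7 .s1)) := rfl
  rw [← alt_rotate, alt_append] at h₅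
  have h₆ := widen (b + 2) (List.replicate 6 .s1)
  have h₇ := widen (b + 4) (List.replicate 4 .s1)
  have h₈ := widen (b + 6) (List.replicate 2 .s1)
  have h₉ := widen (b + 8) []
  have h₁₀ := fill_with_ones (b + 10)
  have h₁₁ := sweep_right_ones m [.s1, .s1, .s1] []
  rw [tri_self, List.append_nil, hm, show 2 * b + 20 = 2 * (b + 10) by ring] at h₁₁
  have h₁₂ : reaches 2 (listCfg .C (tri .s1 .s1 .s0 m [.s1, .s1, .s1]) .s1 [])
    (listCfg .C (.s1 :: .s0 :: tri .s1 .s1 .s0 m [.s1, .s1, .s1]) .s0 []) := rfl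
  rw [← tri_rotate, tri_append] at h₁₂
  exact (((((((((((h₁.trans h₂).trans h₃).trans h₄).trans h₅).trans h₆).trans h₇).trans h₈).trans
    h₉).trans h₁₀).trans h₁₁).trans h₁₂).cast (by omega)

theorem shortEnd_halt (b m : ℕ) (hm : 3 * m + 1 = 2 * b + 22) :
    reaches (22 * b + 199 + 3 * m) (shortEnd b [.s1])
      (listCfg .H (tri .s1 .s1 .s0 (m + 1) [.s1, .s1, .s1]) .s0 []) := by
  have h₁ := shortEnd_bounce b [.s1]
  rw [← alt_rotate, alt_append] at h₁
  have h₂ := widen (b + 1) (List.replicate 8 .s1)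
  have h₃ := widen (b + 3) (List.replicate 6 .s1)
  have h₄ := widen (b + 5) (List.replicate 4 .s1)
  have h₅ := widen (b + 7) (List.replicate 2 .s1)
  have h₆ := widen (b + 9) []
  have h₇ := fill_with_ones (b + 11)
  have h₈ := sweep_right_ones m [.s1, .s1, .s1] [.s1]
  rw [tri_self, show [Gam.s1] = List.replicate 1 .s1 from rfl, List.replicate_append_replicate, hm,
    show 2 * b + 22 = 2 * (b + 11) by ring] at h₈
  have h₉ : reaches 3 (listCfg .C (tri .s1 .s1 .s0 m [.s1, .s1, .s1]) .s1 [.s1])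
    (listCfg .H (tri .s1 .s1 .s0 (m + 1) [.s1, .s1, .s1]) .s0 []) := rfl
  exact ((((((((h₁.trans h₂).trans h₃).trans h₄).trans h₅).trans h₆).trans h₇).trans h₈).trans
    h₉).cast (by omega)

/-- When no group `110` is left, the whole tape is rewritten into groups `110`. -/
theorem longEnd_regroup (n m : ℕ) (hm : 3 * m = 8 * n + 36) :
    reaches (16 * n * n + 206 * n + 528) (longEnd (n + 1) [.s1])
      (listCfg .C (.s1 :: tri .s0 .s1 .s1 (m + 1) [.s1]) .s0 []) := by
  have h := ((longEnd_unfold n [.s1]).trans (shortEnd_consume_pair (4 * n + 4) [])).trans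
    (shortEnd_regroup (4 * n + 8) m (by omega))
  exact h.cast (by rw [hm]; ring)

/-- When a single group `110` is left, the machine halts, provided the length is suitable. -/
theorem longEnd_halt (n m : ℕ) (hm : 3 * m = 8 * n + 39) :
    reaches (16 * n * n + 206 * n + 580) (longEnd (n + 1) (tri .s0 .s1 .s1 1 [.s1]))
      (listCfg .H (tri .s1 .s1 .s0 (m + 1) [.s1, .s1, .s1]) .s0 []) := by
  have h := ((longEnd_unfold n (tri .s0 .s1 .s1 1 [.s1])).trans
    (shortEnd_consume_group_zero (4 * n + 4) [.s1])).trans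
    (shortEnd_halt (4 * n + 9) m (by omega))
  exact h.cast (by rw [hm]; ring)

theorem rounds_from_groups (j k : ℕ) :
    ∃ n t, reaches t (listCfg .C (.s1 :: tri .s0 .s1 .s1 (k + 3 * (j + 1)) [.s1]) .s0 [])
        (longEnd (n + 1) (tri .s0 .s1 .s1 k [.s1])) ∧
      3 * n + 16 = 25 * 4 ^ j ∧
      27 * t + 15 * j + 950 * 4 ^ j = 2000 * (4 ^ j * 4 ^ j) + 489 := by
  obtain ⟨n, t, h, hn, ht⟩ := longEnd_rounds j k [.s1]
  have h₀ := initial_groups (tri .s0 .s1 .s1 (k + 3 * j) [.s1])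
  exact ⟨n, _, h₀.trans h, hn, by omega⟩

/-- A run from a block of `3 j + 4` groups `110` to the halting state. -/
theorem groups_halt (j : ℕ) (hj : 3 ∣ j) :
    ∃ K t, reaches t (listCfg .C (.s1 :: tri .s0 .s1 .s1 (1 + 3 * (j + 1)) [.s1]) .s0 [])
        (listCfg .H (tri .s1 .s1 .s0 K [.s1, .s1, .s1]) .s0 []) ∧
      9 * K + 2 = 200 * 4 ^ j ∧
      27 * t + 15 * j + 1227 = 32000 * (4 ^ j * 4 ^ j) + 7000 * 4 ^ j := by
  obtain ⟨n, t, h, hn, ht⟩ := rounds_from_groups j 1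
  have hmod : 4 ^ j % 9 = 1 := by
    obtain ⟨i, rfl⟩ := hj
    rw [pow_mul, Nat.pow_mod]
    norm_num
  clear hj
  generalize 4 ^ j = x at *
  obtain ⟨m, hm⟩ : ∃ m, 3 * m = 8 * n + 39 := ⟨(8 * n + 39) / 3, by omega⟩
  refine ⟨m + 1, _, h.trans (longEnd_halt n m hm), by omega, ?_⟩
  zify at *
  have hx : (3 * n : ℤ) = 25 * x - 16 := by linarith
  have : (9 * (n * n) : ℤ) = (25 * x - 16) ^ 2 := by rw [← hx]; ring
  linarith

/-- The run from the blank tape to a tape of `91021` groups `110`. -/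
theorem blank_to_groups :
    reaches 19885171064 (listCfg .A [] .s0 [])
      (listCfg .C (.s1 :: tri .s0 .s1 .s1 91021 [.s1]) .s0 []) := by
  have h₁ := (blank_start.trans (initial_groups [.s1])).trans (longEnd_regroup 3 20 rfl)
  obtain ⟨n, t, h₂, hn, ht⟩ := rounds_from_groups 6 0
  obtain rfl : n = 34128 := by omega
  obtain rfl : t = 1242612637 := by omega
  exact ((h₁.trans h₂).trans (longEnd_regroup 34128 91020 (by norm_num))).cast (by norm_num)

theorem sixteen_pow_add_two (n : ℕ) : 16 ^ (n + 2) = 256 * (4 ^ n * 4 ^ n) := by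
  rw [← mul_pow]; norm_num [pow_add, mul_comm]

theorem stmt9 :
    reaches ((125*16^30341 + 1750*4^30340 + 15)/27 + 19885154163)
      (mkCfg [] .A .s0 [])
      (mkCfg ([.s1, .s1, .s1] ++
          (List.replicate ((50*4^30340 - 2)/9) [Gam.s0, .s1, .s1]).flatten) .H .s0 []) := by
  obtain ⟨K, t, h, hK, ht⟩ := groups_halt 30339 ⟨10113, rfl⟩
  have h₁ := blank_to_groups.trans h
  have e₁ : 16 ^ 30341 = 256 * (4 ^ 30339 * 4 ^ 30339) := sixteen_pow_add_two 30339
  have e₂ : 4 ^ 30340 = 4 * 4 ^ 30339 := pow_succ' 4 30339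
  rw [e₁, e₂]
  generalize 4 ^ 30339 = x at *
  generalize x * x = y at *
  obtain rfl : K = (50 * (4 * x) - 2) / 9 := by omega
  have h₂ := h₁.cast
    (t := (125 * (256 * y) + 1750 * (4 * x) + 15) / 27 + 19885154163) (by omega)
  unfold mkCfg
  rw [List.reverse_append, show ([Gam.s1, .s1, .s1] : List Gam).reverse = [.s1, .s1, .s1] from rfl,
    tri_reverse]
  exact h₂
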